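/- Let p₀, p₁, q₀, q₁, p_ρ, p_σ be nonnegative reals with p₀ + p₁ = 1, q₀ + q₁ = 1, p_ρ + p_σ = 1, and let ρ⁰, ρ¹, σ⁰, σ¹ be Hermitian positive semidefinite d×d complex matrices of trace 1. Define the block-diagonal matrices ρ_AE = blockDiagonal of (p₀ • ρ⁰, p₁ • ρ¹) and σ_AE = blockDiagonal of (q₀ • σ⁰, q₁ • σ¹), the matrices ρ_E = p₀ • ρ⁰ + p₁ • ρ¹, σ_E = q₀ • σ⁰ + q₁ • σ¹, and the mixtures χ_AE = p_ρ • ρ_AE + p_σ • σ_AE and χ_E = p_ρ • ρ_E + p_σ • σ_E. Then S(χ_AE) − S(χ_E) ≥ p_ρ·(S(ρ_AE) − S(ρ_E)) + p_σ·(S(σ_AE) − S(σ_E)). -/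

import Mathlib

open scoped BigOperators ComplexOrder

/-- `η x = -x·log₂ x`, with `η 0 = 0`. -/
noncomputable def eta (x : ℝ) : ℝ := -x * Real.logb 2 x

/-- Von Neumann entropy (base 2) of a matrix: the sum of `η` applied to the
eigenvalues when the matrix is Hermitian, `0` otherwise. -/
noncomputable def vnEntropy {n : Type*} [Fintype n] [DecidableEq n]
    (M : Matrix n n ℂ) : ℝ :=
  if h : M.IsHermitian then ∑ i, eta (h.eigenvalues i) else 0

open Matrix

section RelativeEntropy

variable {n : Type*} [Fintype n]

/-- Squared moduli of the entries of the change of basis `Vᴴ * U`. -/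
noncomputable def overlap (U V : Matrix n n ℂ) (j i : n) : ℝ :=
  Complex.normSq ((Vᴴ * U) j i)

lemma overlap_nonneg (U V : Matrix n n ℂ) (j i : n) : 0 ≤ overlap U V j i :=
  Complex.normSq_nonneg _

/-- `⟨A, (L_B + t R_A)⁻¹ A⟩` in terms of the spectral decompositions of `A` and `B`. -/
noncomputable def resolventForm (U V : Matrix n n ℂ) (a b : n → ℝ) (t : ℝ) : ℝ :=
  ∑ j, ∑ i, overlap U V j i * (a i ^ 2 / (b j + t * a i))

/-- The integral of `resolventForm U V a b` over `[0, T]`. -/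
noncomputable def logForm (U V : Matrix n n ℂ) (a b : n → ℝ) (T : ℝ) : ℝ :=
  ∑ j, ∑ i, overlap U V j i * a i * (Real.log (b j + T * a i) - Real.log (b j))

/-- The relative entropy (natural logarithm) of the matrices with eigenvalues `a`, `b` and
eigenvector matrices `U`, `V`. -/
noncomputable def relEntropy (U V : Matrix n n ℂ) (a b : n → ℝ) : ℝ :=
  ∑ j, ∑ i, overlap U V j i * a i * (Real.log (a i) - Real.log (b j))

/-- The support of the first matrix is contained in that of the second. -/
def SupportLE (U V : Matrix n n ℂ) (a b : n → ℝ) : Prop :=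
  ∀ j i, b j = 0 → overlap U V j i * a i = 0

lemma logForm_zero (U V : Matrix n n ℂ) (a b : n → ℝ) : logForm U V a b 0 = 0 := by
  simp [logForm]

lemma hasDerivAt_logForm (U V : Matrix n n ℂ) {a b : n → ℝ} (ha : ∀ i, 0 ≤ a i)
    (hb : ∀ j, 0 ≤ b j) {t : ℝ} (ht : 0 < t) :
    HasDerivAt (logForm U V a b) (resolventForm U V a b t) t := by
  unfold logForm resolventForm
  refine HasDerivAt.fun_sum fun j _ => HasDerivAt.fun_sum fun i _ => ?_
  rcases (ha i).eq_or_lt with h | h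
  · simpa [← h] using hasDerivAt_const t (0 : ℝ)
  · have hpos : b j + t * a i ≠ 0 := (add_pos_of_nonneg_of_pos (hb j) (mul_pos ht h)).ne'
    have h₁ : HasDerivAt (fun T : ℝ => b j + T * a i) (a i) t := by
      simpa using ((hasDerivAt_id t).mul_const (a i)).const_add (b j)
    exact (((h₁.log hpos).sub_const (Real.log (b j))).const_mul (overlap U V j i * a i)).congr_deriv
      (by ring)

lemma continuousOn_logForm {U V : Matrix n n ℂ} {a b : n → ℝ} (ha : ∀ i, 0 ≤ a i)
    (hb : ∀ j, 0 ≤ b j) (hs : SupportLE U V a b) :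
    ContinuousOn (logForm U V a b) (Set.Ici 0) := by
  unfold logForm
  refine continuousOn_finsetSum _ fun j _ => continuousOn_finsetSum _ fun i _ => ?_
  rcases (hb j).eq_or_lt with h | h
  · simpa [hs j i h.symm] using continuousOn_const
  · refine continuousOn_const.mul (ContinuousOn.sub (ContinuousOn.log (by fun_prop) ?_)
      continuousOn_const)
    exact fun T hT => (add_pos_of_pos_of_nonneg h (mul_nonneg hT (ha i))).ne'

variable [DecidableEq n]

lemma conjTranspose_mul_self_of_mem_unitary {U : Matrix n n ℂ} (hU : U ∈ unitaryGroup n ℂ) :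
    Uᴴ * U = 1 := (mem_unitaryGroup_iff').1 hU

lemma sum_overlap {U V : Matrix n n ℂ} (hU : U ∈ unitaryGroup n ℂ)
    (hV : V ∈ unitaryGroup n ℂ) (i : n) : ∑ j, overlap U V j i = 1 := by
  have hW : (Vᴴ * U)ᴴ * (Vᴴ * U) = 1 := by
    have hV' : V * Vᴴ = 1 := mem_unitaryGroup_iff.1 hV
    rw [conjTranspose_mul, conjTranspose_conjTranspose, Matrix.mul_assoc, ← Matrix.mul_assoc V, hV',
      Matrix.one_mul, conjTranspose_mul_self_of_mem_unitary hU]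
  have h := congrFun (congrFun hW i) i
  rw [Matrix.mul_apply, one_apply_eq] at h
  have h' := congrArg Complex.re h
  simpa [overlap, Complex.normSq_apply, -conjTranspose_mul] using h'

lemma conj_diagonal_apply_self (U V : Matrix n n ℂ) (a : n → ℝ) (j : n) :
    (Vᴴ * (U * diagonal (fun i => (a i : ℂ)) * Uᴴ) * V) j j
      = ((∑ i, overlap U V j i * a i : ℝ) : ℂ) := by
  have h : Vᴴ * (U * diagonal (fun i => (a i : ℂ)) * Uᴴ) * V
      = (Vᴴ * U) * diagonal (fun i => (a i : ℂ)) * (Vᴴ * U)ᴴ := by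
    simp [Matrix.mul_assoc]
  rw [h, Matrix.mul_apply, Complex.ofReal_sum]
  refine Finset.sum_congr rfl fun i _ => ?_
  rw [mul_diagonal, conjTranspose_apply, overlap, Complex.ofReal_mul, Complex.normSq_eq_conj_mul_self]
  simp only [Complex.star_def]
  ring

/-- The concave quadratic functional whose supremum over `Y` is
`⟨A, (L_B + t R_A)⁻¹ A⟩`, where `L_B` and `R_A` denote left and right multiplication. -/
noncomputable def quadFunctional (t : ℝ) (A B Y : Matrix n n ℂ) : ℝ :=
  2 * (trace (Yᴴ * A)).re - (trace (Yᴴ * B * Y)).re - t * (trace (Y * A * Yᴴ)).re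

lemma quadFunctional_combo (t p q : ℝ) (A B C D Y : Matrix n n ℂ) :
    quadFunctional t (p • A + q • C) (p • B + q • D) Y
      = p * quadFunctional t A B Y + q * quadFunctional t C D Y := by
  simp [quadFunctional, Matrix.mul_add, Matrix.add_mul, trace_add, trace_smul]
  ring

lemma quadFunctional_conj {U V : Matrix n n ℂ} (hU : U ∈ unitaryGroup n ℂ)
    (hV : V ∈ unitaryGroup n ℂ) (a b : n → ℝ) (t : ℝ) (Z : Matrix n n ℂ) :
    quadFunctional t (U * diagonal (fun i => (a i : ℂ)) * Uᴴ)
        (V * diagonal (fun i => (b i : ℂ)) * Vᴴ) (V * Z * Uᴴ)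
      = ∑ j, ∑ i, (2 * (a i * (star (Z j i) * (Vᴴ * U) j i).re)
          - (b j + t * a i) * Complex.normSq (Z j i)) := by
  have hU' := conjTranspose_mul_self_of_mem_unitary hU
  have hV' := conjTranspose_mul_self_of_mem_unitary hV
  have h₁ : trace ((V * Z * Uᴴ)ᴴ * (U * diagonal (fun i => (a i : ℂ)) * Uᴴ))
      = trace (Zᴴ * ((Vᴴ * U) * diagonal (fun i => (a i : ℂ)))) := by
    rw [show (V * Z * Uᴴ)ᴴ * (U * diagonal (fun i => (a i : ℂ)) * Uᴴ)
      = U * (Zᴴ * ((Vᴴ * U) * diagonal (fun i => (a i : ℂ))) * Uᴴ) by simp [Matrix.mul_assoc],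
      trace_mul_comm, Matrix.mul_assoc, hU', Matrix.mul_one]
  have h₂ : trace ((V * Z * Uᴴ)ᴴ * (V * diagonal (fun i => (b i : ℂ)) * Vᴴ) * (V * Z * Uᴴ))
      = trace (Zᴴ * (diagonal (fun i => (b i : ℂ)) * Z)) := by
    rw [show (V * Z * Uᴴ)ᴴ * (V * diagonal (fun i => (b i : ℂ)) * Vᴴ) * (V * Z * Uᴴ)
      = U * (Zᴴ * ((Vᴴ * V) * diagonal (fun i => (b i : ℂ)) * (Vᴴ * V) * Z) * Uᴴ) by
        simp [Matrix.mul_assoc],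
      trace_mul_comm, Matrix.mul_assoc, hU', hV', Matrix.mul_one, Matrix.mul_one, Matrix.one_mul]
  have h₃ : trace ((V * Z * Uᴴ) * (U * diagonal (fun i => (a i : ℂ)) * Uᴴ) * (V * Z * Uᴴ)ᴴ)
      = trace (Zᴴ * (Z * diagonal (fun i => (a i : ℂ)))) := by
    rw [show (V * Z * Uᴴ) * (U * diagonal (fun i => (a i : ℂ)) * Uᴴ) * (V * Z * Uᴴ)ᴴ
      = V * (Z * (Uᴴ * U) * diagonal (fun i => (a i : ℂ)) * (Uᴴ * U) * Zᴴ * Vᴴ) by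
        simp [Matrix.mul_assoc],
      trace_mul_comm, Matrix.mul_assoc, hU', hV', Matrix.mul_one, Matrix.mul_one, Matrix.mul_one,
      trace_mul_comm]
  rw [quadFunctional, h₁, h₂, h₃, Finset.sum_comm]
  simp only [trace, diag_apply, Matrix.mul_apply (M := Zᴴ), mul_diagonal, diagonal_mul,
    conjTranspose_apply, Complex.re_sum, Finset.mul_sum, ← Finset.sum_sub_distrib]
  refine Finset.sum_congr rfl fun i _ => Finset.sum_congr rfl fun j _ => ?_
  simp [Complex.normSq_apply]
  ring

lemma quad_le_sq_div {a c : ℝ} (hc : 0 ≤ c) (hac : c = 0 → a = 0) (z w : ℂ) :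
    2 * (a * (star z * w).re) - c * Complex.normSq z ≤ Complex.normSq w * (a ^ 2 / c) := by
  rcases hc.eq_or_lt with h | h
  · simp [← h, hac h.symm]
  · rw [← mul_div_assoc, le_div_iff₀ h]
    simp only [Complex.normSq_apply, Complex.star_def, Complex.mul_re, Complex.conj_re,
      Complex.conj_im]
    nlinarith [sq_nonneg (c * z.re - a * w.re), sq_nonneg (c * z.im - a * w.im)]

lemma quad_eq_sq_div (a c : ℝ) (w : ℂ) :
    2 * (a * (star (((a / c : ℝ) : ℂ) * w) * w).re)
      - c * Complex.normSq (((a / c : ℝ) : ℂ) * w) = Complex.normSq w * (a ^ 2 / c) := by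
  by_cases h : c = 0
  · simp [h]
  · simp only [Complex.normSq_apply, Complex.star_def, Complex.mul_re, Complex.conj_re,
      Complex.conj_im, Complex.mul_im, Complex.ofReal_re, Complex.ofReal_im]
    field_simp
    ring

lemma eq_zero_of_add_mul_eq_zero {a b t : ℝ} (ha : 0 ≤ a) (hb : 0 ≤ b) (ht : 0 < t)
    (h : b + t * a = 0) : a = 0 := by
  have := mul_nonneg ht.le ha
  have h' : t * a = 0 := by linarith
  exact (mul_eq_zero.1 h').resolve_left ht.ne'

lemma quadFunctional_le_resolventForm {U V : Matrix n n ℂ} (hU : U ∈ unitaryGroup n ℂ)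
    (hV : V ∈ unitaryGroup n ℂ) {a b : n → ℝ} (ha : ∀ i, 0 ≤ a i) (hb : ∀ j, 0 ≤ b j) {t : ℝ}
    (ht : 0 < t) (Y : Matrix n n ℂ) :
    quadFunctional t (U * diagonal (fun i => (a i : ℂ)) * Uᴴ)
        (V * diagonal (fun i => (b i : ℂ)) * Vᴴ) Y ≤ resolventForm U V a b t := by
  have hU' : U * Uᴴ = 1 := mem_unitaryGroup_iff.1 hU
  have hV' : V * Vᴴ = 1 := mem_unitaryGroup_iff.1 hV
  have hY : Y = V * (Vᴴ * Y * U) * Uᴴ := by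
    rw [show V * (Vᴴ * Y * U) * Uᴴ = (V * Vᴴ) * Y * (U * Uᴴ) by simp [Matrix.mul_assoc], hU', hV',
      Matrix.one_mul, Matrix.mul_one]
  rw [hY, quadFunctional_conj hU hV]
  refine Finset.sum_le_sum fun j _ => Finset.sum_le_sum fun i _ => quad_le_sq_div ?_ ?_ _ _
  · exact add_nonneg (hb j) (mul_nonneg ht.le (ha i))
  · exact eq_zero_of_add_mul_eq_zero (ha i) (hb j) ht

lemma exists_quadFunctional_eq_resolventForm {U V : Matrix n n ℂ} (hU : U ∈ unitaryGroup n ℂ)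
    (hV : V ∈ unitaryGroup n ℂ) (a b : n → ℝ) (t : ℝ) :
    ∃ Y, quadFunctional t (U * diagonal (fun i => (a i : ℂ)) * Uᴴ)
        (V * diagonal (fun i => (b i : ℂ)) * Vᴴ) Y = resolventForm U V a b t := by
  refine ⟨V * Matrix.of (fun j i => ((a i / (b j + t * a i) : ℝ) : ℂ) * (Vᴴ * U) j i) * Uᴴ, ?_⟩
  rw [quadFunctional_conj hU hV]
  refine Finset.sum_congr rfl fun j _ => Finset.sum_congr rfl fun i _ => ?_
  exact quad_eq_sq_div _ _ _

lemma tendsto_logForm_sub {U V : Matrix n n ℂ} (hU : U ∈ unitaryGroup n ℂ)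
    (hV : V ∈ unitaryGroup n ℂ) {a b : n → ℝ} (ha : ∀ i, 0 ≤ a i) (hb : ∀ j, 0 ≤ b j) :
    Filter.Tendsto (fun T => logForm U V a b T - Real.log T * ∑ i, a i) Filter.atTop
      (nhds (relEntropy U V a b)) := by
  have htr : ∑ i, a i = ∑ j, ∑ i, overlap U V j i * a i := by
    rw [Finset.sum_comm]
    simp [← Finset.sum_mul, sum_overlap hU hV]
  have heq : (fun T => logForm U V a b T - Real.log T * ∑ i, a i) = fun T =>
      ∑ j, ∑ i, overlap U V j i * a i
        * (Real.log (b j + T * a i) - Real.log T - Real.log (b j)) := by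
    funext T
    rw [htr, logForm]
    simp only [Finset.mul_sum, ← Finset.sum_sub_distrib]
    exact Finset.sum_congr rfl fun j _ => Finset.sum_congr rfl fun i _ => by ring
  rw [heq]
  refine tendsto_finsetSum _ fun j _ => tendsto_finsetSum _ fun i _ => ?_
  rcases (ha i).eq_or_lt with h | h
  · simp [← h]
  · refine Filter.Tendsto.const_mul _ (Filter.Tendsto.sub_const ?_ _)
    have h₁ : Filter.Tendsto (fun T : ℝ => Real.log (b j / T + a i)) Filter.atTop
        (nhds (Real.log (a i))) := by
      refine Filter.Tendsto.log ?_ h.ne'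
      simpa using (Filter.tendsto_id.const_div_atTop (b j)).add_const (a i)
    refine h₁.congr' ?_
    filter_upwards [Filter.eventually_gt_atTop 0] with T hT
    rw [← Real.log_div (add_pos_of_nonneg_of_pos (hb j) (mul_pos hT h)).ne' hT.ne']
    congr 1
    field_simp

lemma re_trace_conj_diagonal {U : Matrix n n ℂ} (hU : U ∈ unitaryGroup n ℂ) (a : n → ℝ) :
    (trace (U * diagonal (fun i => (a i : ℂ)) * Uᴴ)).re = ∑ i, a i := by
  rw [trace_mul_comm, ← Matrix.mul_assoc, conjTranspose_mul_self_of_mem_unitary hU, Matrix.one_mul,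
    trace_diagonal, Complex.re_sum]
  simp

/-- A spectral decomposition of a positive semidefinite matrix. -/
structure IsSpectral (A U : Matrix n n ℂ) (a : n → ℝ) : Prop where
  mem_unitary : U ∈ unitaryGroup n ℂ
  nonneg : ∀ i, 0 ≤ a i
  eq_conj : A = U * diagonal (fun i => (a i : ℂ)) * Uᴴ

lemma IsSpectral.of_eq {A B U : Matrix n n ℂ} {a : n → ℝ} (h : IsSpectral A U a) (hAB : A = B) :
    IsSpectral B U a := hAB ▸ h

/-- Joint convexity of the relative entropy. -/
theorem relEntropy_jointly_convex {p q : ℝ} (hp : 0 ≤ p) (hq : 0 ≤ q)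
    {A B C D UA UB UC UD UX UY : Matrix n n ℂ} {a b c d x y : n → ℝ}
    (hA : IsSpectral A UA a) (hB : IsSpectral B UB b) (hC : IsSpectral C UC c)
    (hD : IsSpectral D UD d) (hX : IsSpectral (p • A + q • C) UX x)
    (hY : IsSpectral (p • B + q • D) UY y)
    (hAB : SupportLE UA UB a b) (hCD : SupportLE UC UD c d) (hXY : SupportLE UX UY x y) :
    relEntropy UX UY x y ≤ p * relEntropy UA UB a b + q * relEntropy UC UD c d := by
  have hres : ∀ t, 0 < t → resolventForm UX UY x y t
      ≤ p * resolventForm UA UB a b t + q * resolventForm UC UD c d t := by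
    intro t ht
    obtain ⟨Z, hZ⟩ := exists_quadFunctional_eq_resolventForm hX.mem_unitary hY.mem_unitary
      x y t
    rw [← hZ, ← hX.eq_conj, ← hY.eq_conj, quadFunctional_combo]
    have h₁ := quadFunctional_le_resolventForm hA.mem_unitary hB.mem_unitary hA.nonneg hB.nonneg
      ht Z
    have h₂ := quadFunctional_le_resolventForm hC.mem_unitary hD.mem_unitary hC.nonneg hD.nonneg
      ht Z
    rw [← hA.eq_conj, ← hB.eq_conj] at h₁
    rw [← hC.eq_conj, ← hD.eq_conj] at h₂
    gcongr
  have hmono : MonotoneOn (fun T => p * logForm UA UB a b T + q * logForm UC UD c d T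
      - logForm UX UY x y T) (Set.Ici 0) := by
    have hd : ∀ t ∈ interior (Set.Ici (0 : ℝ)), HasDerivAt
        (fun T => p * logForm UA UB a b T + q * logForm UC UD c d T - logForm UX UY x y T)
        (p * resolventForm UA UB a b t + q * resolventForm UC UD c d t
          - resolventForm UX UY x y t) t := by
      intro t ht
      rw [interior_Ici] at ht
      exact (((hasDerivAt_logForm UA UB hA.nonneg hB.nonneg ht).const_mul p).add
        ((hasDerivAt_logForm UC UD hC.nonneg hD.nonneg ht).const_mul q)).sub
        (hasDerivAt_logForm UX UY hX.nonneg hY.nonneg ht)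
    refine monotoneOn_of_deriv_nonneg (convex_Ici 0) ?_
      (fun t ht => (hd t ht).differentiableAt.differentiableWithinAt) fun t ht => ?_
    · exact ((continuousOn_const.mul (continuousOn_logForm hA.nonneg hB.nonneg hAB)).add
        (continuousOn_const.mul (continuousOn_logForm hC.nonneg hD.nonneg hCD))).sub
        (continuousOn_logForm hX.nonneg hY.nonneg hXY)
    · rw [(hd t ht).deriv]
      rw [interior_Ici] at ht
      exact sub_nonneg.2 (hres t ht)
  have htr : ∑ i, x i = p * ∑ i, a i + q * ∑ i, c i := by
    rw [← re_trace_conj_diagonal hX.mem_unitary, ← re_trace_conj_diagonal hA.mem_unitary,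
      ← re_trace_conj_diagonal hC.mem_unitary, ← hX.eq_conj, ← hA.eq_conj, ← hC.eq_conj]
    simp
  refine le_of_tendsto_of_tendsto
    (tendsto_logForm_sub hX.mem_unitary hY.mem_unitary hX.nonneg hY.nonneg)
    (((tendsto_logForm_sub hA.mem_unitary hB.mem_unitary hA.nonneg hB.nonneg).const_mul p).add
      ((tendsto_logForm_sub hC.mem_unitary hD.mem_unitary hC.nonneg hD.nonneg).const_mul q)) ?_
  filter_upwards [Filter.eventually_ge_atTop 0] with T hT
  have h := hmono (Set.mem_Ici.2 le_rfl) (Set.mem_Ici.2 hT) hT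
  simp only [logForm_zero] at h
  rw [htr]
  linarith

lemma sum_overlap_add {A B UA UB V : Matrix n n ℂ} {a b e : n → ℝ} (hA : IsSpectral A UA a)
    (hB : IsSpectral B UB b) (hE : IsSpectral (A + B) V e) (j : n) :
    ∑ i, overlap UA V j i * a i + ∑ i, overlap UB V j i * b i = e j := by
  have h₁ : (Vᴴ * (A + B) * V) j j = (e j : ℂ) := by
    have hV := conjTranspose_mul_self_of_mem_unitary hE.mem_unitary
    rw [hE.eq_conj, show Vᴴ * (V * diagonal (fun i => (e i : ℂ)) * Vᴴ) * V
      = (Vᴴ * V) * diagonal (fun i => (e i : ℂ)) * (Vᴴ * V) by simp [Matrix.mul_assoc], hV]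
    simp
  rw [Matrix.mul_add, Matrix.add_mul, Matrix.add_apply, hA.eq_conj, hB.eq_conj,
    conj_diagonal_apply_self, conj_diagonal_apply_self] at h₁
  exact_mod_cast h₁

lemma supportLE_add_left {A B UA UB V : Matrix n n ℂ} {a b e : n → ℝ} (hA : IsSpectral A UA a)
    (hB : IsSpectral B UB b) (hE : IsSpectral (A + B) V e) : SupportLE UA V a e := by
  intro j i hj
  have h := sum_overlap_add hA hB hE j
  have h₁ : ∀ i ∈ Finset.univ, 0 ≤ overlap UA V j i * a i := fun i _ =>
    mul_nonneg (overlap_nonneg _ _ _ _) (hA.nonneg i)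
  have h₂ : 0 ≤ ∑ i, overlap UB V j i * b i := Finset.sum_nonneg fun i _ =>
    mul_nonneg (overlap_nonneg _ _ _ _) (hB.nonneg i)
  have h₃ : ∑ i, overlap UA V j i * a i = 0 :=
    le_antisymm (by linarith) (Finset.sum_nonneg h₁)
  exact (Finset.sum_eq_zero_iff_of_nonneg h₁).1 h₃ i (Finset.mem_univ i)

lemma relEntropy_eq {U V : Matrix n n ℂ} (hU : U ∈ unitaryGroup n ℂ)
    (hV : V ∈ unitaryGroup n ℂ) (a b : n → ℝ) :
    relEntropy U V a b = ∑ i, a i * Real.log (a i)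
      - ∑ j, (∑ i, overlap U V j i * a i) * Real.log (b j) := by
  simp only [relEntropy, mul_sub, Finset.sum_sub_distrib, Finset.sum_mul]
  congr 1
  rw [Finset.sum_comm]
  refine Finset.sum_congr rfl fun i _ => ?_
  simp only [mul_assoc]
  rw [← Finset.sum_mul, sum_overlap hU hV, one_mul]

/-- `S(A + B) - S(A ⊕ B)` as a sum of relative entropies. -/
lemma relEntropy_add_relEntropy {A B UA UB V : Matrix n n ℂ} {a b e : n → ℝ}
    (hA : IsSpectral A UA a) (hB : IsSpectral B UB b) (hE : IsSpectral (A + B) V e) :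
    relEntropy UA V a e + relEntropy UB V b e
      = ∑ i, a i * Real.log (a i) + ∑ i, b i * Real.log (b i) - ∑ j, e j * Real.log (e j) := by
  rw [relEntropy_eq hA.mem_unitary hE.mem_unitary, relEntropy_eq hB.mem_unitary hE.mem_unitary]
  simp only [← sum_overlap_add hA hB hE, add_mul, Finset.sum_add_distrib]
  ring

end RelativeEntropy

section Entropy

variable {n : Type*} [Fintype n] [DecidableEq n]

lemma isSpectral_of_posSemidef {A : Matrix n n ℂ} (hA : A.PosSemidef) :
    IsSpectral A hA.isHermitian.eigenvectorUnitary hA.isHermitian.eigenvalues where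
  mem_unitary := hA.isHermitian.eigenvectorUnitary.2
  nonneg := hA.eigenvalues_nonneg
  eq_conj := by
    conv_lhs => rw [hA.isHermitian.spectral_theorem]
    rfl

lemma vnEntropy_eq_neg_sum_div {A : Matrix n n ℂ} (hA : A.IsHermitian) :
    vnEntropy A = -(∑ i, hA.eigenvalues i * Real.log (hA.eigenvalues i)) / Real.log 2 := by
  rw [vnEntropy, dif_pos hA, ← Finset.sum_neg_distrib, Finset.sum_div]
  exact Finset.sum_congr rfl fun i _ => by rw [eta, Real.logb]; ring

/-- Concavity of the conditional entropy of classical-quantum states. -/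
theorem vnEntropy_conditional_concave {p q : ℝ} (hp : 0 ≤ p) (hq : 0 ≤ q)
    {A B C D : Matrix n n ℂ} (hA : A.PosSemidef) (hB : B.PosSemidef) (hC : C.PosSemidef)
    (hD : D.PosSemidef) :
    p * (vnEntropy A + vnEntropy B - vnEntropy (A + B))
        + q * (vnEntropy C + vnEntropy D - vnEntropy (C + D))
      ≤ vnEntropy (p • A + q • C) + vnEntropy (p • B + q • D)
        - vnEntropy (p • (A + B) + q • (C + D)) := by
  have hX : (p • A + q • C).PosSemidef := (hA.smul hp).add (hC.smul hq)
  have hY : (p • B + q • D).PosSemidef := (hB.smul hp).add (hD.smul hq)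
  have hE : (p • (A + B) + q • (C + D)).PosSemidef :=
    ((hA.add hB).smul hp).add ((hC.add hD).smul hq)
  have sA := isSpectral_of_posSemidef hA
  have sB := isSpectral_of_posSemidef hB
  have sC := isSpectral_of_posSemidef hC
  have sD := isSpectral_of_posSemidef hD
  have sX := isSpectral_of_posSemidef hX
  have sY := isSpectral_of_posSemidef hY
  have sE := isSpectral_of_posSemidef hE
  have sAB := isSpectral_of_posSemidef (hA.add hB)
  have sCD := isSpectral_of_posSemidef (hC.add hD)
  have eXY : p • (A + B) + q • (C + D) = (p • A + q • C) + (p • B + q • D) := by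
    simp only [smul_add]; abel
  have sBA := sAB.of_eq (add_comm A B)
  have sDC := sCD.of_eq (add_comm C D)
  have sXY := sE.of_eq eXY
  have sYX := sE.of_eq (eXY.trans (add_comm _ _))
  have h₁ := relEntropy_jointly_convex hp hq sA sAB sC sCD sX sE (supportLE_add_left sA sB sAB)
    (supportLE_add_left sC sD sCD) (supportLE_add_left sX sY sXY)
  have h₂ := relEntropy_jointly_convex hp hq sB sAB sD sCD sY sE (supportLE_add_left sB sA sBA)
    (supportLE_add_left sD sC sDC) (supportLE_add_left sY sX sYX)
  have e₁ := relEntropy_add_relEntropy sA sB sAB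
  have e₂ := relEntropy_add_relEntropy sC sD sCD
  have e₃ := relEntropy_add_relEntropy sX sY sXY
  rw [vnEntropy_eq_neg_sum_div hA.isHermitian, vnEntropy_eq_neg_sum_div hB.isHermitian,
    vnEntropy_eq_neg_sum_div hC.isHermitian, vnEntropy_eq_neg_sum_div hD.isHermitian,
    vnEntropy_eq_neg_sum_div hX.isHermitian, vnEntropy_eq_neg_sum_div hY.isHermitian,
    vnEntropy_eq_neg_sum_div hE.isHermitian, vnEntropy_eq_neg_sum_div (hA.add hB).isHermitian,
    vnEntropy_eq_neg_sum_div (hC.add hD).isHermitian]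
  simp only [← add_div, ← sub_div, mul_div_assoc']
  refine div_le_div_of_nonneg_right ?_ (Real.log_pos one_lt_two).le
  linear_combination h₁ + h₂ + p * e₁ + q * e₂ - e₃

lemma vnEntropy_eq_sum_roots {A : Matrix n n ℂ} (hA : A.IsHermitian) :
    vnEntropy A = (A.charpoly.roots.map fun z => eta z.re).sum := by
  rw [vnEntropy, dif_pos hA, hA.roots_charpoly_eq_eigenvalues]
  simp

lemma charpoly_blockDiagonal {o : Type*} [Fintype o] [DecidableEq o] (M : o → Matrix n n ℂ) :
    (blockDiagonal M).charpoly = ∏ k, (M k).charpoly := by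
  have h : (blockDiagonal M).charmatrix = blockDiagonal fun k => (M k).charmatrix := by
    ext ⟨i, k⟩ ⟨j, l⟩
    by_cases hkl : k = l
    · subst hkl
      simp [charmatrix_apply, blockDiagonal_apply, diagonal_apply]
    · simp [blockDiagonal_apply, hkl]
  rw [charpoly, h, det_blockDiagonal]
  rfl

lemma vnEntropy_blockDiagonal_pair {A B : Matrix n n ℂ} (hA : A.IsHermitian)
    (hB : B.IsHermitian) :
    vnEntropy (blockDiagonal ![A, B]) = vnEntropy A + vnEntropy B := by
  have h : (blockDiagonal ![A, B]).IsHermitian := by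
    rw [IsHermitian, blockDiagonal_conjTranspose]
    congr 1
    funext k
    fin_cases k
    · exact hA
    · exact hB
  rw [vnEntropy_eq_sum_roots h, vnEntropy_eq_sum_roots hA, vnEntropy_eq_sum_roots hB,
    charpoly_blockDiagonal, Fin.prod_univ_two,
    Polynomial.roots_mul (mul_ne_zero (charpoly_monic _).ne_zero (charpoly_monic _).ne_zero)]
  simp

end Entropy

theorem stmt2 (d : ℕ)
    (p₀ p₁ q₀ q₁ pρ pσ : ℝ)
    (hp₀ : 0 ≤ p₀) (hp₁ : 0 ≤ p₁) (hq₀ : 0 ≤ q₀) (hq₁ : 0 ≤ q₁)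
    (hpρ : 0 ≤ pρ) (hpσ : 0 ≤ pσ)
    (hp : p₀ + p₁ = 1) (hq : q₀ + q₁ = 1) (hpρσ : pρ + pσ = 1)
    (ρ0 ρ1 σ0 σ1 : Matrix (Fin d) (Fin d) ℂ)
    (hρ0 : ρ0.PosSemidef) (hρ1 : ρ1.PosSemidef)
    (hσ0 : σ0.PosSemidef) (hσ1 : σ1.PosSemidef)
    (hρ0t : ρ0.trace = 1) (hρ1t : ρ1.trace = 1)
    (hσ0t : σ0.trace = 1) (hσ1t : σ1.trace = 1)
    (ρAE : Matrix (Fin d × Fin 2) (Fin d × Fin 2) ℂ)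
    (hρAE : ρAE = Matrix.blockDiagonal ![p₀ • ρ0, p₁ • ρ1])
    (σAE : Matrix (Fin d × Fin 2) (Fin d × Fin 2) ℂ)
    (hσAE : σAE = Matrix.blockDiagonal ![q₀ • σ0, q₁ • σ1])
    (ρE σE : Matrix (Fin d) (Fin d) ℂ)
    (hρE : ρE = p₀ • ρ0 + p₁ • ρ1) (hσE : σE = q₀ • σ0 + q₁ • σ1)
    (χAE : Matrix (Fin d × Fin 2) (Fin d × Fin 2) ℂ)
    (hχAE : χAE = pρ • ρAE + pσ • σAE)
    (χE : Matrix (Fin d) (Fin d) ℂ)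
    (hχE : χE = pρ • ρE + pσ • σE) :
    vnEntropy χAE - vnEntropy χE ≥
      pρ * (vnEntropy ρAE - vnEntropy ρE) +
      pσ * (vnEntropy σAE - vnEntropy σE) := by
  have hA := hρ0.smul hp₀
  have hB := hρ1.smul hp₁
  have hC := hσ0.smul hq₀
  have hD := hσ1.smul hq₁
  have hχ : χAE = Matrix.blockDiagonal
      ![pρ • p₀ • ρ0 + pσ • q₀ • σ0, pρ • p₁ • ρ1 + pσ • q₁ • σ1] := by
    rw [hχAE, hρAE, hσAE, ← Matrix.blockDiagonal_smul, ← Matrix.blockDiagonal_smul,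
      ← Matrix.blockDiagonal_add]
    simp
  rw [hχ, hχE, hρAE, hσAE, hρE, hσE,
    vnEntropy_blockDiagonal_pair ((hA.smul hpρ).add (hC.smul hpσ)).isHermitian
      ((hB.smul hpρ).add (hD.smul hpσ)).isHermitian,
    vnEntropy_blockDiagonal_pair hA.isHermitian hB.isHermitian,
    vnEntropy_blockDiagonal_pair hC.isHermitian hD.isHermitian]
  exact vnEntropy_conditional_concave hpρ hpσ hA hB hC hD
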